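/- Let V be a real vector space, M ⊆ V a nonempty convex set whose affine span is all of V, and ≽ a preorder on M satisfying SI. Let C = {λ•(x − y) : λ > 0, x, y ∈ M, x ≽ y} ⊆ V be the positive cone of ≽. Then ≽ satisfies MC if and only if C is algebraically closed. -/

import Mathlib

open Cardinal

variable {V : Type*} [AddCommGroup V] [Module ℝ V]

/-- `u : V → ℝ` is mixture preserving on the convex set `M`. -/
def MixPres (M : Set V) (u : V → ℝ) : Prop :=
  ∀ x ∈ M, ∀ y ∈ M, ∀ α : ℝ, 0 ≤ α → α ≤ 1 →
    u (α • x + (1 - α) • y) = α * u x + (1 - α) * u y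

/-- Axiom MR: existence of a mixture-preserving multi-representation of `r` on `M`. -/
def AxMR (M : Set V) (r : V → V → Prop) : Prop :=
  ∃ U : Set (V → ℝ), U.Nonempty ∧ (∀ u ∈ U, MixPres M u) ∧
    ∀ x ∈ M, ∀ y ∈ M, (r x y ↔ ∀ u ∈ U, u x ≥ u y)

/-- Axiom MC (mixture continuity). -/
def AxMC (M : Set V) (r : V → V → Prop) : Prop :=
  ∀ x ∈ M, ∀ y ∈ M, ∀ z ∈ M,
    (∀ α : ℝ, 0 < α → α ≤ 1 →
      r (α • x + (1 - α) • y) z ∧ ¬ r z (α • x + (1 - α) • y)) →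
    r y z

/-- Axiom SI (strong independence). -/
def AxSI (M : Set V) (r : V → V → Prop) : Prop :=
  ∀ x ∈ M, ∀ y ∈ M, ∀ z ∈ M, ∀ α : ℝ, 0 < α → α < 1 →
    (r x y ↔ r (α • x + (1 - α) • z) (α • y + (1 - α) • z))

/-- Axiom CD (countable domination). -/
def AxCD (M : Set V) (r : V → V → Prop) : Prop :=
  ∃ D : Set (V × V), D.Countable ∧
    (∀ p ∈ D, p.1 ∈ M ∧ p.2 ∈ M ∧ r p.1 p.2) ∧
    ∀ s ∈ M, ∀ t ∈ M, r s t →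
      ∃ p ∈ D, ∃ α : ℝ, 0 < α ∧ α < 1 ∧
        r (α • p.1 + (1 - α) • t) (α • p.2 + (1 - α) • s)

/-- Axiom SD (singleton domination). -/
def AxSD (M : Set V) (r : V → V → Prop) : Prop :=
  ∃ x ∈ M, ∃ y ∈ M, r x y ∧
    ∀ s ∈ M, ∀ t ∈ M, r s t →
      ∃ α : ℝ, 0 < α ∧ α < 1 ∧
        r (α • x + (1 - α) • t) (α • y + (1 - α) • s)

/-- The positive cone of the preorder `r` on `M`. -/
def posCone (M : Set V) (r : V → V → Prop) : Set V :=
  {v | ∃ l : ℝ, 0 < l ∧ ∃ x ∈ M, ∃ y ∈ M, r x y ∧ v = l • (x - y)}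

/-- A set is algebraically closed. -/
def AlgClosed (S : Set V) : Prop :=
  ∀ v w : V, (∀ α : ℝ, 0 < α → α ≤ 1 → (1 - α) • v + α • w ∈ S) → v ∈ S

/-- The weak topology on a real vector space: the coarsest topology making all
linear functionals continuous. -/
def weakTop (W : Type*) [AddCommGroup W] [Module ℝ W] : TopologicalSpace W :=
  ⨅ f : W →ₗ[ℝ] ℝ, TopologicalSpace.induced (⇑f) inferInstance

/-- The linear span of the set of differences of elements of `M`. -/
def diffSpan (M : Set V) : Submodule ℝ V :=
  Submodule.span ℝ {v | ∃ x ∈ M, ∃ y ∈ M, v = x - y}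

/-- `u` is strictly increasing for `r` on `M`. -/
def StrIncr (M : Set V) (r : V → V → Prop) (u : V → ℝ) : Prop :=
  (∀ x ∈ M, ∀ y ∈ M, r x y → u x ≥ u y) ∧
  (∀ x ∈ M, ∀ y ∈ M, r x y → ¬ r y x → u x > u y)

theorem posCone_smul_mem {M : Set V} {r : V → V → Prop} {v : V} {c : ℝ} (hc : 0 < c)
    (hv : v ∈ posCone M r) : c • v ∈ posCone M r := by
  obtain ⟨l, hl, x, hx, y, hy, hxy, rfl⟩ := hv
  exact ⟨c * l, mul_pos hc hl, x, hx, y, hy, hxy, smul_smul _ _ _⟩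

theorem sub_mem_posCone {M : Set V} {r : V → V → Prop} {x y : V} (hx : x ∈ M) (hy : y ∈ M)
    (h : r x y) : x - y ∈ posCone M r :=
  ⟨1, one_pos, x, hx, y, hy, h, (one_smul _ _).symm⟩

theorem Convex.mix_mem {M : Set V} (hconv : Convex ℝ M) {x y : V} (hx : x ∈ M) (hy : y ∈ M)
    {t : ℝ} (h₀ : 0 ≤ t) (h₁ : t ≤ 1) : t • x + (1 - t) • y ∈ M :=
  hconv hx hy h₀ (sub_nonneg.2 h₁) (add_sub_cancel _ _)

theorem posCone_add_mem {M : Set V} {r : V → V → Prop} (hconv : Convex ℝ M)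
    (htrans : ∀ x ∈ M, ∀ y ∈ M, ∀ z ∈ M, r x y → r y z → r x z) (hSI : AxSI M r)
    {v w : V} (hv : v ∈ posCone M r) (hw : w ∈ posCone M r) : v + w ∈ posCone M r := by
  obtain ⟨l, hl, x, hx, y, hy, hxy, rfl⟩ := hv
  obtain ⟨m, hm, x', hx', y', hy', hxy', rfl⟩ := hw
  have hlm : 0 < l + m := add_pos hl hm
  have h₀ : 0 < l / (l + m) := div_pos hl hlm
  have h₁ : l / (l + m) < 1 := (div_lt_one hlm).2 (by linarith)
  have key : r ((l / (l + m)) • x + (1 - l / (l + m)) • x')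
      ((l / (l + m)) • y + (1 - l / (l + m)) • y') := by
    refine htrans _ (hconv.mix_mem hx hx' h₀.le h₁.le) _ (hconv.mix_mem hy hx' h₀.le h₁.le) _
      (hconv.mix_mem hy hy' h₀.le h₁.le) ((hSI x hx y hy x' hx' _ h₀ h₁).1 hxy) ?_
    have h := (hSI x' hx' y' hy' y hy (1 - l / (l + m)) (by linarith) (by linarith)).1 hxy'
    rwa [sub_sub_cancel, add_comm, add_comm _ ((l / (l + m)) • y)] at h
  refine ⟨l + m, hlm, _, hconv.mix_mem hx hx' h₀.le h₁.le, _,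
    hconv.mix_mem hy hy' h₀.le h₁.le, key, ?_⟩
  match_scalars <;> field_simp <;> ring

theorem rel_iff_sub_mem_posCone {M : Set V} {r : V → V → Prop}
    (hSI : AxSI M r) {x y : V} (hx : x ∈ M) (hy : y ∈ M) : r x y ↔ x - y ∈ posCone M r := by
  refine ⟨sub_mem_posCone hx hy, ?_⟩
  rintro ⟨l, hl, a, ha, b, hb, hab, h⟩
  have hl1 : 0 < l + 1 := by linarith
  have h₀ : 0 < l / (l + 1) := div_pos hl hl1
  have h₁ : l / (l + 1) < 1 := (div_lt_one hl1).2 (by linarith)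
  have hmix := (hSI a ha b hb y hy _ h₀ h₁).1 hab
  refine (hSI x hx y hy b hb (1 - l / (l + 1)) (by linarith) (by linarith)).2 ?_
  have hx' : x = y + l • (a - b) := by rw [← h]; abel
  convert hmix using 1
  · rw [hx']
    match_scalars <;> field_simp <;> ring
  · rw [sub_sub_cancel, add_comm]

theorem mem_posCone_true {M : Set V} (hM : M.Nonempty) (hconv : Convex ℝ M)
    (haff : affineSpan ℝ M = ⊤) (v : V) : v ∈ posCone M (fun _ _ ↦ True) := by
  have hv : v ∈ vectorSpan ℝ M := by
    rw [← direction_affineSpan, haff, AffineSubspace.direction_top]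
    trivial
  have hpos {c : ℝ} {u : V} (hc : 0 < c) := posCone_smul_mem (M := M)
    (r := fun _ _ ↦ True) (v := u) hc
  have hzero : (0 : V) ∈ posCone M (fun _ _ ↦ True) := by
    obtain ⟨x, hx⟩ := hM
    simpa using sub_mem_posCone (r := fun _ _ ↦ True) hx hx trivial
  have hneg {u : V} : u ∈ posCone M (fun _ _ ↦ True) → -u ∈ posCone M (fun _ _ ↦ True) := by
    rintro ⟨l, hl, x, hx, y, hy, -, rfl⟩
    exact ⟨l, hl, y, hy, x, hx, trivial, by rw [← smul_neg, neg_sub]⟩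
  refine Submodule.span_induction ?_ hzero ?_ ?_ hv
  · rintro _ ⟨x, hx, y, hy, rfl⟩
    exact sub_mem_posCone hx hy trivial
  · exact fun u w _ _ hu hw ↦ posCone_add_mem hconv (fun _ _ _ _ _ _ _ _ ↦ trivial)
      (fun _ _ _ _ _ _ _ _ _ ↦ Iff.rfl) hu hw
  · intro c u _ hu
    rcases lt_trichotomy c 0 with hc | rfl | hc
    · simpa using hpos (neg_pos.2 hc) (hneg hu)
    · simpa using hzero
    · exact hpos hc hu

/-- Two vectors, rescaled by a common positive factor, are differences of points of `M` with a
common base point. -/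
theorem exists_common_base {M : Set V} (hM : M.Nonempty) (hconv : Convex ℝ M)
    (haff : affineSpan ℝ M = ⊤) (v w : V) :
    ∃ s : ℝ, 0 < s ∧ ∃ z ∈ M, z + s • v ∈ M ∧ z + s • w ∈ M := by
  obtain ⟨l, hl, a, ha, b, hb, -, rfl⟩ := mem_posCone_true hM hconv haff v
  obtain ⟨m, hm, c, hc, d, hd, -, rfl⟩ := mem_posCone_true hM hconv haff w
  have hlm : 0 < l + m := add_pos hl hm
  have hl₁ : l / (l + m) ≤ 1 := (div_le_one hlm).2 (by linarith)
  have hm₁ : m / (l + m) ≤ 1 := (div_le_one hlm).2 (by linarith)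
  have hmid {p q : V} (hp : p ∈ M) (hq : q ∈ M) :=
    hconv.mix_mem hp hq (t := 1 / 2) (by norm_num) (by norm_num)
  refine ⟨1 / (2 * (l + m)), by positivity, _, hmid hb hd, ?_, ?_⟩
  · convert hmid (hconv.mix_mem ha hb (div_pos hl hlm).le hl₁) hd using 1
    match_scalars <;> field_simp <;> ring
  · convert hmid hb (hconv.mix_mem hc hd (div_pos hm hlm).le hm₁) using 1
    match_scalars <;> field_simp <;> ring

/-- If a segment minus its endpoint `v` lies in the cone, and the negative of one of its points
does too, then so does the negative of the other endpoint. -/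
theorem neg_mem_posCone_of_neg_mix_mem {M : Set V} {r : V → V → Prop}
    (hadd : ∀ {v w : V}, v ∈ posCone M r → w ∈ posCone M r → v + w ∈ posCone M r) {v w : V}
    (h : ∀ α : ℝ, 0 < α → α ≤ 1 → (1 - α) • v + α • w ∈ posCone M r) {α : ℝ} (h₀ : 0 < α)
    (h₁ : α ≤ 1) (hneg : -((1 - α) • v + α • w) ∈ posCone M r) : -w ∈ posCone M r := by
  rcases h₁.eq_or_lt with rfl | h₁
  · simpa using hneg
  have hα : 0 < 1 - α := by linarith
  have hsum := hadd (posCone_smul_mem (c := 2 * (1 - α) / α) (by positivity)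
      (h (α / 2) (by linarith) (by linarith)))
    (posCone_smul_mem (c := (2 - α) / α) (div_pos (by linarith) h₀) hneg)
  convert hsum using 1
  match_scalars <;> field_simp <;> ring

theorem stmt_7 (M : Set V) (hM : M.Nonempty) (hconv : Convex ℝ M)
    (haff : affineSpan ℝ M = ⊤)
    (r : V → V → Prop) (hrefl : ∀ x ∈ M, r x x)
    (htrans : ∀ x ∈ M, ∀ y ∈ M, ∀ z ∈ M, r x y → r y z → r x z)
    (hSI : AxSI M r) :
    AxMC M r ↔ AlgClosed (posCone M r) := by
  have hadd {v w : V} := posCone_add_mem (v := v) (w := w) hconv htrans hSI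
  constructor
  · intro hMC v w h
    by_cases hw : -w ∈ posCone M r
    · have hsum := hadd (posCone_smul_mem two_pos (h (1 / 2) (by norm_num) (by norm_num))) hw
      convert hsum using 1
      match_scalars <;> norm_num
    obtain ⟨s, hs, z, hz, hy, hx⟩ := exists_common_base hM hconv haff v w
    have hdiff (α : ℝ) : α • (z + s • w) + (1 - α) • (z + s • v) - z
        = s • ((1 - α) • v + α • w) := by
      match_scalars <;> ring
    have hyz : r (z + s • v) z := by
      refine hMC _ hx _ hy _ hz fun α h₀ h₁ ↦ ?_
      have hmem := hconv.mix_mem hx hy h₀.le h₁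
      rw [rel_iff_sub_mem_posCone hSI hmem hz, rel_iff_sub_mem_posCone hSI hz hmem,
        ← neg_sub _ z, hdiff]
      refine ⟨posCone_smul_mem hs (h α h₀ h₁), fun hneg ↦ hw ?_⟩
      refine neg_mem_posCone_of_neg_mix_mem hadd h h₀ h₁ ?_
      simpa [smul_smul, hs.ne'] using posCone_smul_mem (inv_pos.2 hs) hneg
    rw [rel_iff_sub_mem_posCone hSI hy hz, add_sub_cancel_left] at hyz
    simpa [smul_smul, hs.ne'] using posCone_smul_mem (inv_pos.2 hs) hyz
  · intro hC x hx y hy z hz h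
    rw [rel_iff_sub_mem_posCone hSI hy hz]
    refine hC _ (x - z) fun α h₀ h₁ ↦ ?_
    convert sub_mem_posCone (hconv.mix_mem hx hy h₀.le h₁) hz (h α h₀ h₁).1 using 1
    match_scalars <;> ring
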